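/- Let γ ∈ (−3, 1]. There exist constants 0 < c ≤ C, depending only on γ, such that for every v ∈ ℝ³, c · ⟨v⟩^γ ≤ ∫_{ℝ³} μ(v_*) |v − v_*|^γ dv_* ≤ C · ⟨v⟩^γ. -/

import Mathlib

open MeasureTheory

noncomputable section

/-- Japanese bracket `⟨v⟩ = (1 + |v|²)^(1/2)`. -/
def jb (v : EuclideanSpace ℝ (Fin 3)) : ℝ := (1 + ‖v‖ ^ 2) ^ ((1 : ℝ) / 2)

/-- Standard Maxwellian `μ(v) = (2π)^(-3/2) exp(-|v|²/2)` on `ℝ³`. -/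
def maxw (v : EuclideanSpace ℝ (Fin 3)) : ℝ :=
  (2 * Real.pi) ^ (-(3 : ℝ) / 2) * Real.exp (-‖v‖ ^ 2 / 2)

lemma jb_sq (v : EuclideanSpace ℝ (Fin 3)) : jb v ^ 2 = 1 + ‖v‖ ^ 2 := by
  rw [jb, ← Real.sqrt_eq_rpow, Real.sq_sqrt (by positivity)]

lemma jb_pos (v : EuclideanSpace ℝ (Fin 3)) : 0 < jb v :=
  Real.rpow_pos_of_pos (by positivity) _

lemma one_le_jb (v : EuclideanSpace ℝ (Fin 3)) : 1 ≤ jb v :=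
  le_of_sq_le_sq (by rw [jb_sq]; nlinarith [sq_nonneg ‖v‖]) (jb_pos v).le

lemma norm_le_jb (v : EuclideanSpace ℝ (Fin 3)) : ‖v‖ ≤ jb v :=
  le_of_sq_le_sq (by rw [jb_sq]; linarith) (jb_pos v).le

lemma jb_le_one_add_norm (v : EuclideanSpace ℝ (Fin 3)) : jb v ≤ 1 + ‖v‖ :=
  le_of_sq_le_sq (by rw [jb_sq]; nlinarith [norm_nonneg v]) (by positivity)

lemma norm_sub_le_jb_mul (v w : EuclideanSpace ℝ (Fin 3)) :
    ‖v - w‖ ≤ jb v * (1 + ‖w‖) := by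
  nlinarith [norm_sub_le v w, norm_le_jb v, one_le_jb v, norm_nonneg w]

lemma jb_le_mul_norm_sub (v w : EuclideanSpace ℝ (Fin 3)) :
    jb v ≤ (1 + ‖v - w‖) * (1 + ‖w‖) := by
  have h : ‖v‖ ≤ ‖v - w‖ + ‖w‖ := norm_le_norm_sub_add v w
  nlinarith [jb_le_one_add_norm v, mul_nonneg (norm_nonneg (v - w)) (norm_nonneg w)]

lemma maxw_pos (v : EuclideanSpace ℝ (Fin 3)) : 0 < maxw v := by
  unfold maxw; positivity

lemma continuous_maxw : Continuous maxw := by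
  unfold maxw; fun_prop

lemma integrable_gaussian {b : ℝ} (hb : 0 < b) :
    Integrable fun w : EuclideanSpace ℝ (Fin 3) ↦ Real.exp (-b * ‖w‖ ^ 2) := by
  refine .of_integral_ne_zero ?_
  rw [GaussianFourier.integral_rexp_neg_mul_sq_norm hb]
  positivity

lemma integrable_maxw : Integrable maxw := by
  refine ((integrable_gaussian one_half_pos).const_mul ((2 * Real.pi) ^ (-(3 : ℝ) / 2))).congr
    (.of_forall fun w ↦ ?_)
  simp only [maxw]
  ring_nf

lemma integrable_indicator_ball_norm_rpow {γ : ℝ} (hγ : -3 < γ) :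
    Integrable ((Metric.ball (0 : EuclideanSpace ℝ (Fin 3)) 1).indicator (‖·‖ ^ γ)) := by
  have hloc : LocallyIntegrable fun z : EuclideanSpace ℝ (Fin 3) ↦ ‖z‖ ^ γ :=
    locallyIntegrable_of_norm_le_rpow (C := 1) (α := -γ) (by simp) (by simp; linarith)
      (.of_forall fun z ↦ by simp [abs_of_nonneg (Real.rpow_nonneg (norm_nonneg z) γ)])
      (measurable_norm.pow_const γ).aestronglyMeasurable
  exact (integrable_indicator_iff measurableSet_ball).2
    ((hloc.integrableOn_isCompact (isCompact_closedBall 0 1)).mono_set Metric.ball_subset_closedBall)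

lemma one_add_cube_le_exp (x : ℝ) (hx : 0 ≤ x) :
    (1 + x) ^ 3 ≤ 216 * Real.exp (x ^ 2 / 4) := by
  have h : 1 + x ≤ 6 * Real.exp (x ^ 2 / 12) := by
    nlinarith [Real.add_one_le_exp (x ^ 2 / 12), sq_nonneg (x - 1)]
  calc (1 + x) ^ 3 ≤ (6 * Real.exp (x ^ 2 / 12)) ^ 3 := by gcongr
    _ = 216 * Real.exp (x ^ 2 / 4) := by
      rw [mul_pow, ← Real.exp_nat_mul]; norm_num; ring_nf

lemma maxw_mul_one_add_norm_cube_le (w : EuclideanSpace ℝ (Fin 3)) :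
    maxw w * (1 + ‖w‖) ^ 3 ≤
      216 * (2 * Real.pi) ^ (-(3 : ℝ) / 2) * Real.exp (-(1 / 4) * ‖w‖ ^ 2) := by
  calc maxw w * (1 + ‖w‖) ^ 3 ≤ maxw w * (216 * Real.exp (‖w‖ ^ 2 / 4)) := by
        gcongr
        · exact (maxw_pos w).le
        · exact one_add_cube_le_exp _ (norm_nonneg w)
    _ = 216 * (2 * Real.pi) ^ (-(3 : ℝ) / 2) *
          (Real.exp (-‖w‖ ^ 2 / 2) * Real.exp (‖w‖ ^ 2 / 4)) := by rw [maxw]; ring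
    _ = _ := by rw [← Real.exp_add]; ring_nf

lemma norm_sub_rpow_le {γ : ℝ} (hγ : γ ∈ Set.Ioc (-3 : ℝ) 1)
    (v w : EuclideanSpace ℝ (Fin 3)) :
    ‖v - w‖ ^ γ ≤ 8 * jb v ^ γ * (1 + ‖w‖) ^ 3 *
      (1 + (Metric.ball (0 : EuclideanSpace ℝ (Fin 3)) 1).indicator (‖·‖ ^ γ) (v - w)) := by
  obtain ⟨hγ3, hγ1⟩ := hγ
  have hJ : 0 < jb v ^ γ := Real.rpow_pos_of_pos (jb_pos v) γ
  have hP : 1 ≤ 1 + ‖w‖ := by linarith [norm_nonneg w]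
  have hr : 0 ≤ ‖v - w‖ ^ γ := Real.rpow_nonneg (norm_nonneg _) γ
  have hind : 0 ≤ (Metric.ball (0 : EuclideanSpace ℝ (Fin 3)) 1).indicator (‖·‖ ^ γ) (v - w) :=
    Set.indicator_nonneg (fun z _ ↦ Real.rpow_nonneg (norm_nonneg z) γ) _
  rcases le_or_gt 0 γ with h0 | h0
  · have h1 : ‖v - w‖ ^ γ ≤ jb v ^ γ * (1 + ‖w‖) ^ 3 := by
      calc ‖v - w‖ ^ γ ≤ (jb v * (1 + ‖w‖)) ^ γ :=
            Real.rpow_le_rpow (norm_nonneg _) (norm_sub_le_jb_mul v w) h0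
        _ = jb v ^ γ * (1 + ‖w‖) ^ γ := Real.mul_rpow (jb_pos v).le (by positivity)
        _ ≤ jb v ^ γ * (1 + ‖w‖) ^ (3 : ℝ) := by gcongr; linarith
        _ = jb v ^ γ * (1 + ‖w‖) ^ 3 := by norm_cast
    have h2 : 0 ≤ jb v ^ γ * (1 + ‖w‖) ^ 3 := by positivity
    nlinarith
  · have h1 : (1 + ‖v - w‖) ^ γ ≤ jb v ^ γ * (1 + ‖w‖) ^ 3 := by
      have hle : (1 + ‖v - w‖) ^ γ * (1 + ‖w‖) ^ γ ≤ jb v ^ γ := by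
        rw [← Real.mul_rpow (by positivity) (by positivity)]
        exact Real.rpow_le_rpow_of_nonpos (jb_pos v) (jb_le_mul_norm_sub v w) h0.le
      calc (1 + ‖v - w‖) ^ γ
          = (1 + ‖v - w‖) ^ γ * (1 + ‖w‖) ^ γ * (1 + ‖w‖) ^ (-γ) := by
            rw [mul_assoc, ← Real.rpow_add (by positivity)]; simp
        _ ≤ jb v ^ γ * (1 + ‖w‖) ^ (3 : ℝ) := by gcongr; linarith
        _ = jb v ^ γ * (1 + ‖w‖) ^ 3 := by norm_cast
    have h2 : (1 : ℝ) / 8 ≤ 2 ^ γ := by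
      calc (1 : ℝ) / 8 = 2 ^ (-3 : ℝ) := by norm_num [Real.rpow_neg]
        _ ≤ 2 ^ γ := Real.rpow_le_rpow_of_exponent_le (by norm_num) hγ3.le
    have h3 : 0 ≤ jb v ^ γ * (1 + ‖w‖) ^ 3 := by positivity
    rcases lt_or_ge ‖v - w‖ 1 with hlt | hge
    · rw [Set.indicator_of_mem (by simpa using hlt)]
      have h4 : (2 : ℝ) ^ γ ≤ (1 + ‖v - w‖) ^ γ :=
        Real.rpow_le_rpow_of_nonpos (by positivity) (by linarith) h0.le
      nlinarith
    · have h4 : (2 * ‖v - w‖) ^ γ ≤ (1 + ‖v - w‖) ^ γ :=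
        Real.rpow_le_rpow_of_nonpos (by positivity) (by linarith) h0.le
      rw [Real.mul_rpow (by norm_num) (norm_nonneg _)] at h4
      nlinarith

lemma maxw_mul_norm_sub_rpow_le {γ : ℝ} (hγ : γ ∈ Set.Ioc (-3 : ℝ) 1)
    (v w : EuclideanSpace ℝ (Fin 3)) :
    maxw w * ‖v - w‖ ^ γ ≤ 1728 * (2 * Real.pi) ^ (-(3 : ℝ) / 2) * jb v ^ γ *
      (Real.exp (-(1 / 4) * ‖w‖ ^ 2) +
        (Metric.ball (0 : EuclideanSpace ℝ (Fin 3)) 1).indicator (‖·‖ ^ γ) (v - w)) := by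
  have hind : 0 ≤ (Metric.ball (0 : EuclideanSpace ℝ (Fin 3)) 1).indicator (‖·‖ ^ γ) (v - w) :=
    Set.indicator_nonneg (fun z _ ↦ Real.rpow_nonneg (norm_nonneg z) γ) _
  set h := (Metric.ball (0 : EuclideanSpace ℝ (Fin 3)) 1).indicator (‖·‖ ^ γ) (v - w)
  have hJ : 0 < jb v ^ γ := Real.rpow_pos_of_pos (jb_pos v) γ
  have hexp : Real.exp (-(1 / 4) * ‖w‖ ^ 2) ≤ 1 :=
    Real.exp_le_one_iff.2 (by nlinarith [sq_nonneg ‖w‖])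
  calc maxw w * ‖v - w‖ ^ γ
      ≤ maxw w * (8 * jb v ^ γ * (1 + ‖w‖) ^ 3 * (1 + h)) := by
        gcongr
        · exact (maxw_pos w).le
        · exact norm_sub_rpow_le hγ v w
    _ = 8 * jb v ^ γ * (1 + h) * (maxw w * (1 + ‖w‖) ^ 3) := by ring
    _ ≤ 8 * jb v ^ γ * (1 + h) *
          (216 * (2 * Real.pi) ^ (-(3 : ℝ) / 2) * Real.exp (-(1 / 4) * ‖w‖ ^ 2)) := by
        exact mul_le_mul_of_nonneg_left (maxw_mul_one_add_norm_cube_le w) (by positivity)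
    _ = 1728 * (2 * Real.pi) ^ (-(3 : ℝ) / 2) * jb v ^ γ *
          (Real.exp (-(1 / 4) * ‖w‖ ^ 2) + Real.exp (-(1 / 4) * ‖w‖ ^ 2) * h) := by ring
    _ ≤ _ := by
        gcongr
        exact mul_le_of_le_one_left hind hexp

lemma integrable_maxw_mul_norm_sub_rpow {γ : ℝ} (hγ : γ ∈ Set.Ioc (-3 : ℝ) 1)
    (v : EuclideanSpace ℝ (Fin 3)) : Integrable fun w ↦ maxw w * ‖v - w‖ ^ γ := by
  refine Integrable.mono' (((integrable_gaussian (b := 1 / 4) (by norm_num)).add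
    ((integrable_indicator_ball_norm_rpow hγ.1).comp_sub_left v)).const_mul
      (1728 * (2 * Real.pi) ^ (-(3 : ℝ) / 2) * jb v ^ γ))
    ((continuous_maxw.measurable.mul (by fun_prop)).aestronglyMeasurable)
    (.of_forall fun w ↦ ?_)
  rw [Real.norm_of_nonneg (mul_nonneg (maxw_pos w).le (Real.rpow_nonneg (norm_nonneg _) γ))]
  exact maxw_mul_norm_sub_rpow_le hγ v w

lemma exists_integral_maxw_mul_norm_sub_rpow_le {γ : ℝ} (hγ : γ ∈ Set.Ioc (-3 : ℝ) 1) :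
    ∃ C : ℝ, ∀ v : EuclideanSpace ℝ (Fin 3),
      ∫ w, maxw w * ‖v - w‖ ^ γ ≤ C * jb v ^ γ := by
  have hg := integrable_gaussian (b := 1 / 4) (by norm_num)
  have hh := integrable_indicator_ball_norm_rpow hγ.1
  set h := (Metric.ball (0 : EuclideanSpace ℝ (Fin 3)) 1).indicator (‖·‖ ^ γ)
  refine ⟨1728 * (2 * Real.pi) ^ (-(3 : ℝ) / 2) *
    ((∫ w : EuclideanSpace ℝ (Fin 3), Real.exp (-(1 / 4) * ‖w‖ ^ 2)) + ∫ z, h z), fun v ↦ ?_⟩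
  calc ∫ w, maxw w * ‖v - w‖ ^ γ
      ≤ ∫ w, 1728 * (2 * Real.pi) ^ (-(3 : ℝ) / 2) * jb v ^ γ *
          (Real.exp (-(1 / 4) * ‖w‖ ^ 2) + h (v - w)) :=
        integral_mono (integrable_maxw_mul_norm_sub_rpow hγ v)
          ((hg.add (hh.comp_sub_left v)).const_mul _) (maxw_mul_norm_sub_rpow_le hγ v)
    _ = _ := by
        rw [integral_const_mul, integral_add hg (hh.comp_sub_left v),
          integral_sub_left_eq_self h volume v]
        ring

lemma exists_weight_mul_jb_rpow_le (γ : ℝ) :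
    ∃ q : EuclideanSpace ℝ (Fin 3) → ℝ, Continuous q ∧ (∀ w, 0 ≤ q w) ∧ (∀ w, q w ≤ 1) ∧
      (∃ w, q w ≠ 0) ∧ ∀ v w, v ≠ w → jb v ^ γ * q w ≤ ‖v - w‖ ^ γ + ‖v + w‖ ^ γ := by
  rcases le_or_gt 0 γ with h0 | h0
  · refine ⟨fun w ↦ min 1 ‖w‖ ^ γ, ?_, fun w ↦ by positivity, fun w ↦ ?_, ?_, fun v w _ ↦ ?_⟩
    · exact (continuous_const.min continuous_norm).rpow_const fun _ ↦ .inr h0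
    · exact Real.rpow_le_one (by positivity) (min_le_left _ _) h0
    · exact ⟨EuclideanSpace.single 0 1, by simp⟩
    · have hm0 : 0 ≤ min 1 ‖w‖ := by positivity
      have hmax : jb v * min 1 ‖w‖ ≤ max ‖v - w‖ ‖v + w‖ := by
        refine le_of_sq_le_sq ?_ (by positivity)
        have hpar := parallelogram_law_with_norm ℝ v w
        have h1 : ‖v - w‖ ^ 2 ≤ max ‖v - w‖ ‖v + w‖ ^ 2 := by gcongr; exact le_max_left _ _
        have h2 : ‖v + w‖ ^ 2 ≤ max ‖v - w‖ ‖v + w‖ ^ 2 := by gcongr; exact le_max_right _ _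
        have h3 : min 1 ‖w‖ ^ 2 ≤ 1 := pow_le_one₀ hm0 (min_le_left _ _)
        have h4 : min 1 ‖w‖ ^ 2 ≤ ‖w‖ ^ 2 := by gcongr; exact min_le_right _ _
        rw [mul_pow, jb_sq]
        nlinarith [sq_nonneg ‖v‖]
      rw [← Real.mul_rpow (jb_pos v).le hm0]
      have h1 : 0 ≤ ‖v - w‖ ^ γ := by positivity
      have h2 : 0 ≤ ‖v + w‖ ^ γ := by positivity
      refine (Real.rpow_le_rpow (mul_nonneg (jb_pos v).le hm0) hmax h0).trans ?_
      rcases max_choice ‖v - w‖ ‖v + w‖ with h | h <;> rw [h] <;> linarith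
  · refine ⟨fun w ↦ (1 + ‖w‖) ^ γ, ?_, fun w ↦ by positivity, fun w ↦ ?_, ⟨0, by simp⟩,
      fun v w hvw ↦ ?_⟩
    · exact (continuous_const.add continuous_norm).rpow_const fun w ↦
        .inl (by linarith [norm_nonneg w] : 0 < 1 + ‖w‖).ne'
    · exact Real.rpow_le_one_of_one_le_of_nonpos (by linarith [norm_nonneg w]) h0.le
    · rw [← Real.mul_rpow (jb_pos v).le (by positivity)]
      have h1 : 0 ≤ ‖v + w‖ ^ γ := by positivity
      have h2 : (jb v * (1 + ‖w‖)) ^ γ ≤ ‖v - w‖ ^ γ :=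
        Real.rpow_le_rpow_of_nonpos (norm_pos_iff.2 (sub_ne_zero.2 hvw))
          (norm_sub_le_jb_mul v w) h0.le
      linarith

lemma exists_pos_le_integral_maxw_mul_norm_sub_rpow {γ : ℝ} (hγ : γ ∈ Set.Ioc (-3 : ℝ) 1) :
    ∃ c : ℝ, 0 < c ∧ ∀ v : EuclideanSpace ℝ (Fin 3),
      c * jb v ^ γ ≤ ∫ w, maxw w * ‖v - w‖ ^ γ := by
  obtain ⟨q, hq, hq0, hq1, ⟨e, he⟩, hle⟩ := exists_weight_mul_jb_rpow_le γ
  have hint : Integrable fun w ↦ maxw w * q w := by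
    refine integrable_maxw.mono' (continuous_maxw.mul hq).aestronglyMeasurable
      (.of_forall fun w ↦ ?_)
    rw [Real.norm_of_nonneg (mul_nonneg (maxw_pos w).le (hq0 w))]
    exact mul_le_of_le_one_right (maxw_pos w).le (hq1 w)
  have hpos : 0 < ∫ w, maxw w * q w :=
    integral_pos_of_integrable_nonneg_nonzero (x := e) (continuous_maxw.mul hq) hint
      (fun w ↦ mul_nonneg (maxw_pos w).le (hq0 w)) (mul_ne_zero (maxw_pos e).ne' he)
  refine ⟨(∫ w, maxw w * q w) / 2, half_pos hpos, fun v ↦ ?_⟩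
  have hI := integrable_maxw_mul_norm_sub_rpow hγ v
  have hneg : (fun w ↦ maxw (-w) * ‖v - -w‖ ^ γ) = fun w ↦ maxw w * ‖v + w‖ ^ γ := by
    simp [maxw]
  have hI' : Integrable fun w ↦ maxw w * ‖v + w‖ ^ γ := hneg ▸ hI.comp_neg
  have hsymm : ∫ w, maxw w * ‖v + w‖ ^ γ = ∫ w, maxw w * ‖v - w‖ ^ γ := by
    rw [← hneg, integral_neg_eq_self (fun w ↦ maxw w * ‖v - w‖ ^ γ) volume]
  have key : ∫ w, jb v ^ γ * (maxw w * q w) ≤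
      ∫ w, (maxw w * ‖v - w‖ ^ γ + maxw w * ‖v + w‖ ^ γ) := by
    refine integral_mono_ae (hint.const_mul _) (hI.add hI') ?_
    filter_upwards [Measure.ae_ne volume v] with w hw
    nlinarith [mul_le_mul_of_nonneg_left (hle v w hw.symm) (maxw_pos w).le]
  rw [integral_const_mul, integral_add hI hI', hsymm] at key
  linarith

/-- For `γ ∈ (-3,1]` there exist `0 < c ≤ C` depending only on `γ` with
`c ⟨v⟩^γ ≤ ∫ μ(v_*) |v-v_*|^γ dv_* ≤ C ⟨v⟩^γ` for every `v ∈ ℝ³`. -/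
theorem maxwellian_convolution_equiv_bracket (γ : ℝ) (hγ : γ ∈ Set.Ioc (-3 : ℝ) 1) :
    ∃ c C : ℝ, 0 < c ∧ c ≤ C ∧
      ∀ v : EuclideanSpace ℝ (Fin 3),
        c * jb v ^ γ ≤ (∫ vs, maxw vs * ‖v - vs‖ ^ γ) ∧
        (∫ vs, maxw vs * ‖v - vs‖ ^ γ) ≤ C * jb v ^ γ := by
  obtain ⟨c, hc, hlow⟩ := exists_pos_le_integral_maxw_mul_norm_sub_rpow hγ
  obtain ⟨C, hup⟩ := exists_integral_maxw_mul_norm_sub_rpow_le hγ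
  refine ⟨c, C, hc, ?_, fun v ↦ ⟨hlow v, hup v⟩⟩
  have h := (hlow 0).trans (hup 0)
  simpa [jb] using h
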